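/- Let O be an integral domain such that O/yO is finite for every nonzero y ∈ O. Let S = O^n be the product ring of n copies of O, and let R ⊆ S be a subring such that the additive quotient S/R is finite. Let x ∈ R and write (x_1, …, x_n) for its components in S; assume every x_i is nonzero. Then the quotient ring R/xR is finite and #(R/xR) = #(O/(x_1 x_2 ⋯ x_n)O). -/

import Mathlib

theorem aux_mulLeft_index {O : Type*} [CommRing O] (y : O) :
    (AddMonoidHom.mulLeft y).range.index = Nat.card (O ⧸ Ideal.span {y}) := by
  have : (AddMonoidHom.mulLeft y).range = (Ideal.span {y}).toAddSubgroup := by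
    ext z
    simp only [AddMonoidHom.mem_range, AddMonoidHom.coe_mulLeft, Submodule.mem_toAddSubgroup,
      Ideal.mem_span_singleton']
    simp only [mul_comm]
  rw [this]
  rfl

theorem aux_prod {O : Type*} [CommRing O] [IsDomain O] {ι : Type*} (s : Finset ι) (x : ι → O)
    (hx : ∀ i, x i ≠ 0) :
    Nat.card (O ⧸ Ideal.span {∏ i ∈ s, x i}) = ∏ i ∈ s, Nat.card (O ⧸ Ideal.span {x i}) := by
  classical
  induction s using Finset.induction_on with
  | empty =>
    simp only [Finset.prod_empty, Ideal.span_singleton_one]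
    rw [Nat.card_eq_one_iff_unique]
    exact ⟨Ideal.Quotient.subsingleton_iff.mpr rfl, ⟨0⟩⟩
  | insert a s ha ih =>
    rw [Finset.prod_insert ha, Finset.prod_insert ha, ← ih]
    simp only [← aux_mulLeft_index]
    have h := AddSubgroup.index_map_of_injective (f := AddMonoidHom.mulLeft (x a))
      (AddMonoidHom.mulLeft (∏ i ∈ s, x i)).range (mul_right_injective₀ (hx a))
    rw [mul_comm (AddSubgroup.index _), ← h, AddMonoidHom.map_range]
    congr 2
    ext z
    simp [mul_assoc]

theorem aux_pi {O : Type*} [CommRing O] {n : ℕ} (x : Fin n → O) :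
    (AddMonoidHom.mulLeft x).range.index = ∏ i, Nat.card (O ⧸ Ideal.span {x i}) := by
  rw [← Nat.card_pi, ← Nat.card_congr
    (Submodule.quotientPi (fun i => Ideal.span {x i})).toEquiv]
  have : (AddMonoidHom.mulLeft x).range
      = (Submodule.pi Set.univ (fun i => Ideal.span {x i})).toAddSubgroup := by
    ext z
    simp only [AddMonoidHom.mem_range, AddMonoidHom.coe_mulLeft, Submodule.mem_toAddSubgroup,
      Submodule.mem_pi, Ideal.mem_span_singleton', Set.mem_univ, true_imp_iff]
    constructor
    · rintro ⟨y, rfl⟩ i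
      exact ⟨y i, mul_comm _ _⟩
    · intro h
      choose y hy using h
      exact ⟨y, funext fun i => by rw [Pi.mul_apply, mul_comm, hy]⟩
  rw [this]
  rfl

set_option synthInstance.maxHeartbeats 400000 in
/-- Let `O` be an integral domain such that `O/yO` is finite for every nonzero `y`.  Let
`R ⊆ S = O^n` be a subring of finite additive index and `x ∈ R` with all components
`x i` nonzero.  Then `R/xR` is finite and `#(R/xR) = #(O/(x 1 ⋯ x n)O)`. -/
theorem stmt_2 {O : Type*} [CommRing O] [IsDomain O]
    (hO : ∀ y : O, y ≠ 0 → Finite (O ⧸ Ideal.span {y}))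
    {n : ℕ} (R : Subring (Fin n → O))
    (hRfin : Finite ((Fin n → O) ⧸ R.toAddSubgroup))
    (x : R) (hx : ∀ i, (x : Fin n → O) i ≠ 0) :
    Finite (R ⧸ Ideal.span {x}) ∧
      Nat.card (R ⧸ Ideal.span {x}) =
        Nat.card (O ⧸ Ideal.span {∏ i, (x : Fin n → O) i}) := by
  have key : Nat.card (R ⧸ Ideal.span {x}) =
      Nat.card (O ⧸ Ideal.span {∏ i, (x : Fin n → O) i}) := by
    rw [aux_prod _ _ hx, ← aux_pi, ← aux_mulLeft_index]
    have hinj : Function.Injective (AddMonoidHom.mulLeft (x : Fin n → O)) := by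
      intro a b hab
      funext i
      exact mul_left_cancel₀ (hx i) (congrFun hab i)
    have h1 := AddSubgroup.index_map_of_injective R.toAddSubgroup hinj
    have hle : R.toAddSubgroup.map (AddMonoidHom.mulLeft (x : Fin n → O)) ≤ R.toAddSubgroup := by
      rintro _ ⟨r, hr, rfl⟩
      exact R.mul_mem x.2 hr
    have h2 := AddSubgroup.relIndex_mul_index hle
    have h0 : R.toAddSubgroup.index ≠ 0 := AddSubgroup.index_ne_zero_of_finite
    have h3 : (AddMonoidHom.mulLeft x).range =
        (R.toAddSubgroup.map (AddMonoidHom.mulLeft (x : Fin n → O))).addSubgroupOf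
          R.toAddSubgroup := by
      ext z
      constructor
      · rintro ⟨r, rfl⟩
        exact ⟨r, r.2, rfl⟩
      · rintro ⟨r, hr, h⟩
        exact ⟨⟨r, hr⟩, Subtype.ext h⟩
    rw [h1, mul_comm] at h2
    have h4 := Nat.eq_of_mul_eq_mul_left (Nat.pos_of_ne_zero h0) h2
    rw [← h4]
    exact congrArg AddSubgroup.index h3
  refine ⟨?_, key⟩
  have := hO _ (Finset.prod_ne_zero_iff.mpr fun i _ => hx i : ∏ i, (x : Fin n → O) i ≠ 0)
  refine Nat.finite_of_card_ne_zero ?_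
  rw [key]
  exact Nat.card_pos.ne'
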